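/- Consider the auxiliary monotone (cooperative) system dI/dt = b(1 - I/K)F - (ν_I+μ_I)I, dY/dt = rν_I I - μ_Y Y + δF, dF/dt = ν_Y γMY/(Y+Y_P) - (δ+μ_F)F, dM/dt = (1-r)ν_I I - (μ_M + αY_P/(Y+Y_P))M. There exists a threshold Ỹ_P** > 0 (the tangency value of Y_P for the equation I·ξ(I)·φ̃(I) = η(Y_P,I) on (0, I₁), where φ̃(I) = rν_I b(1 - I/K) + δ(ν_I+μ_I)) such that: (i) if Y_P > Ỹ_P**, TE = (0,0,0,0) is globally asymptotically stable on ℝ⁴₊; (ii) if 0 < Y_P < Ỹ_P**, the system has exactly three equilibria, TE and two positive equilibria Ẽ⁽¹⁾ < Ẽ⁽²⁾ (componentwise); the basin of attraction of TE contains {x ∈ ℝ⁴₊ : 0 ≤ x < Ẽ⁽¹⁾} and the basin of attraction of Ẽ⁽²⁾ contains {x ∈ ℝ⁴₊ : x ≥ Ẽ⁽²⁾, I ≤ K}. -/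

import Mathlib

open Filter Topology Set

noncomputable section

/-- `x` is a (forward) solution of `x' = f x` for `t ≥ 0` remaining in `S`. -/
def IsSolOn (f : (Fin 4 → ℝ) → (Fin 4 → ℝ)) (S : Set (Fin 4 → ℝ))
    (x : ℝ → Fin 4 → ℝ) : Prop :=
  (∀ t : ℝ, 0 ≤ t → HasDerivAt x (f (x t)) t) ∧ ∀ t : ℝ, 0 ≤ t → x t ∈ S

/-- The nonnegative orthant ℝ⁴₊. -/
def Orthant : Set (Fin 4 → ℝ) := {x | ∀ i, 0 ≤ x i}

/-- Lyapunov stability of `p` relative to forward solutions in `S`. -/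
def StableOn (f : (Fin 4 → ℝ) → (Fin 4 → ℝ)) (S : Set (Fin 4 → ℝ)) (p : Fin 4 → ℝ) : Prop :=
  ∀ ε > 0, ∃ d > 0, ∀ x : ℝ → Fin 4 → ℝ, IsSolOn f S x → dist (x 0) p < d →
    ∀ t : ℝ, 0 ≤ t → dist (x t) p < ε

/-- `p` is a globally asymptotically stable equilibrium of `f` on `S`. -/
def GASOn (f : (Fin 4 → ℝ) → (Fin 4 → ℝ)) (S : Set (Fin 4 → ℝ)) (p : Fin 4 → ℝ) : Prop :=
  f p = 0 ∧ StableOn f S p ∧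
    ∀ x : ℝ → Fin 4 → ℝ, IsSolOn f S x → Tendsto x atTop (𝓝 p)

/-- The auxiliary monotone (cooperative) system majorising the full controlled model. -/
def auxMono (b K γ r νI μI νY μY δ μF μM α YP : ℝ) : (Fin 4 → ℝ) → (Fin 4 → ℝ) := fun x =>
  ![b * (1 - x 0 / K) * x 2 - (νI + μI) * x 0,
    r * νI * x 0 - μY * x 1 + δ * x 2,
    νY * γ * x 3 * x 1 / (x 1 + YP) - (δ + μF) * x 2,
    (1 - r) * νI * x 0 - (μM + α * YP / (x 1 + YP)) * x 3]

def EvLe (u : ℝ → ℝ) (a : ℝ) : Prop := ∀ ε > 0, ∀ᶠ t in atTop, u t ≤ a + ε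

lemma weak {u u' : ℝ → ℝ} {a s T : ℝ} (hd : ∀ t ∈ Icc s T, HasDerivAt u (u' t) t)
    (h : ∀ t ∈ Icc s T, a < u t → u' t ≤ 0) (h0 : u s ≤ a) : ∀ t ∈ Icc s T, u t ≤ a := by
  intro t ht
  have key : ∀ η > 0, u t ≤ a + η + η * (t - s) := by
    intro η hη
    refine image_le_of_deriv_right_lt_deriv_boundary (f := u) (f' := u') (a := s) (b := T)
      (B := fun t => a + η + η * (t - s)) (B' := fun _ => η) ?_ ?_ ?_ ?_ ?_ ht
    · exact fun x hx => (hd x hx).continuousAt.continuousWithinAt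
    · exact fun x hx => (hd x ⟨hx.1, hx.2.le⟩).hasDerivWithinAt
    · simp; linarith
    · intro x
      have := (((hasDerivAt_id x).sub_const s).const_mul η).const_add (a + η)
      simpa using this
    · intro x hx hux
      have hx' : x ∈ Icc s T := ⟨hx.1, hx.2.le⟩
      have : 0 ≤ η * (x - s) := mul_nonneg hη.le (by linarith [hx.1])
      have := h x hx' (by rw [hux]; linarith)
      linarith
  by_contra hc
  push Not at hc
  have hts : 0 ≤ t - s := by linarith [ht.1]
  have := key ((u t - a) / (2 * (1 + (t - s)))) (by apply div_pos <;> linarith)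
  have e : (u t - a) / (2 * (1 + (t - s))) + (u t - a) / (2 * (1 + (t - s))) * (t - s)
      = (u t - a) / 2 := by field_simp
  linarith

lemma weak_lower {u u' : ℝ → ℝ} {a s T : ℝ} (hd : ∀ t ∈ Icc s T, HasDerivAt u (u' t) t)
    (h : ∀ t ∈ Icc s T, u t < a → 0 ≤ u' t) (h0 : a ≤ u s) : ∀ t ∈ Icc s T, a ≤ u t := by
  intro t ht
  have := weak (u := fun t => - u t) (u' := fun t => - u' t) (a := -a) (s := s) (T := T)
    (fun t ht => (hd t ht).neg) (fun t ht h1 => by have := h t ht (by linarith); linarith)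
    (by linarith) t ht
  linarith

lemma evle {u u' : ℝ → ℝ} {a C κ : ℝ} (hd : ∀ t, 0 ≤ t → HasDerivAt u (u' t) t) (hκ : 0 < κ)
    (h : ∀ ε > 0, ∀ η > 0, η ≤ 1 → ∀ᶠ t in atTop, a + ε ≤ u t → u' t ≤ C * η - κ * ε) :
    EvLe u a := by
  intro ε hε
  have hC : 0 < |C| + 1 := by positivity
  set η := min 1 (κ * ε / (2 * (|C| + 1))) with hη
  have hη0 : 0 < η := by positivity
  have hη1 : C * η ≤ κ * ε / 2 := by
    calc C * η ≤ (|C| + 1) * η := by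
          apply mul_le_mul_of_nonneg_right _ hη0.le; linarith [le_abs_self C]
      _ ≤ (|C| + 1) * (κ * ε / (2 * (|C| + 1))) :=
          mul_le_mul_of_nonneg_left (min_le_right _ _) hC.le
      _ = κ * ε / 2 := by field_simp
  obtain ⟨T0, hT0⟩ := eventually_atTop.1 (h ε hε η hη0 (min_le_left _ _))
  set T := max T0 0
  set k := κ * ε / 2 with hk
  have hk0 : 0 < k := by positivity
  have hT : ∀ t, T ≤ t → a + ε ≤ u t → u' t ≤ - k := by
    intro t ht hu
    have := hT0 t (le_trans (le_max_left _ _) ht) hu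
    linarith
  have hTp : ∀ t, T ≤ t → 0 ≤ t := fun t ht => le_trans (le_max_right _ _) ht
  obtain ⟨t0, ht0, hut0⟩ : ∃ t0, T ≤ t0 ∧ u t0 ≤ a + ε := by
    by_contra hc
    push Not at hc
    have hlin : ∀ t, T ≤ t → u t ≤ u T - k * (t - T) := by
      intro t ht
      refine image_le_of_deriv_right_le_deriv_boundary (f := u) (f' := u') (a := T) (b := t)
        (B := fun t => u T - k * (t - T)) (B' := fun _ => - k) ?_ ?_ ?_ ?_ ?_ ?_
        (right_mem_Icc.2 ht)
      · exact fun x hx => (hd x (hTp x hx.1)).continuousAt.continuousWithinAt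
      · exact fun x hx => (hd x (hTp x hx.1)).hasDerivWithinAt
      · simp
      · fun_prop
      · intro x hx
        have := (((hasDerivAt_id x).sub_const T).const_mul k).const_sub (u T)
        simpa using this.hasDerivWithinAt
      · intro x hx
        exact hT x hx.1 (hc x hx.1).le
    have hTu := hc T le_rfl
    have h1 : T ≤ T + (u T - a) / k := by
      have : 0 < (u T - a) / k := by apply div_pos <;> linarith
      linarith
    have h2 := hlin _ h1
    have h3 := hc _ h1
    have : k * (T + (u T - a) / k - T) = u T - a := by field_simp; ring
    linarith
  filter_upwards [eventually_ge_atTop t0] with t ht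
  refine weak (u := u) (u' := u') (s := t0) (T := t) (fun x hx => hd x (hTp x (ht0.trans hx.1))) ?_
    hut0 t (right_mem_Icc.2 ht)
  intro x hx hux
  have := hT x (ht0.trans hx.1) hux.le
  linarith

lemma exit_le {u u' : ℝ → ℝ} {a : ℝ} (hd : ∀ t, 0 ≤ t → HasDerivAt u (u' t) t) (h0 : u 0 ≤ a)
    (h : ∀ T, 0 ≤ T → (∀ t ∈ Icc 0 T, u t ≤ a) → u T = a → u' T < 0) :
    ∀ t, 0 ≤ t → u t ≤ a := by
  by_contra hc
  push Not at hc
  obtain ⟨t1, ht1, hut1⟩ := hc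
  set S := {x : ℝ | 0 ≤ x ∧ a < u x} with hS
  have hSb : BddBelow S := ⟨0, fun x hx => hx.1⟩
  have hSn : S.Nonempty := ⟨t1, ht1, hut1⟩
  set τ := sInf S with hτ
  have hτ0 : 0 ≤ τ := le_csInf hSn fun x hx => hx.1
  have hlt : ∀ x, 0 ≤ x → x < τ → u x ≤ a := by
    intro x hx hxt
    by_contra hcc
    push Not at hcc
    have : τ ≤ x := csInf_le hSb ⟨hx, hcc⟩
    linarith
  have hτa : u τ ≤ a := by
    rcases hτ0.eq_or_lt with h1 | h1
    · rw [← h1]; exact h0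
    · have hcont : Tendsto u (𝓝[<] τ) (𝓝 (u τ)) :=
        (hd τ hτ0).continuousAt.tendsto.mono_left nhdsWithin_le_nhds
      refine le_of_tendsto hcont ?_
      filter_upwards [Ioo_mem_nhdsLT h1] with x hx
      exact hlt x hx.1.le hx.2
  have hall : ∀ t ∈ Icc 0 τ, u t ≤ a := by
    intro t ht
    rcases ht.2.eq_or_lt with h1 | h1
    · rw [h1]; exact hτa
    · exact hlt t ht.1 h1
  have hev : ∀ᶠ z in 𝓝[>] τ, u z ≤ a := by
    rcases hτa.eq_or_lt with h1 | h1
    · have hneg := h τ hτ0 hall h1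
      have := ((hd τ hτ0).hasDerivWithinAt (s := Ioi τ)).limsup_slope_le' (by simp) hneg
      filter_upwards [this, self_mem_nhdsWithin] with z hz hz1
      have hz1 : τ < z := hz1
      rw [slope_def_field, div_neg_iff] at hz
      rcases hz with hz | hz
      · linarith [hz.2]
      · linarith [hz.1]
    · have := ((hd τ hτ0).continuousAt.eventually (gt_mem_nhds h1))
      filter_upwards [nhdsWithin_le_nhds this] with z hz using hz.le
  obtain ⟨w, hw, hw2⟩ := (mem_nhdsGT_iff_exists_Ioo_subset).1 hev
  obtain ⟨x, hxS, hxw⟩ := exists_lt_of_csInf_lt hSn (show sInf S < w from hw)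
  have hxt : τ ≤ x := csInf_le hSb hxS
  rcases hxt.eq_or_lt with h1 | h1
  · rw [← h1] at hxS; linarith [hxS.2]
  · have : u x ≤ a := hw2 ⟨h1, hxw⟩
    linarith [hxS.2]

lemma exit_ge {u u' : ℝ → ℝ} {a : ℝ} (hd : ∀ t, 0 ≤ t → HasDerivAt u (u' t) t) (h0 : a ≤ u 0)
    (h : ∀ T, 0 ≤ T → (∀ t ∈ Icc 0 T, a ≤ u t) → u T = a → 0 < u' T) :
    ∀ t, 0 ≤ t → a ≤ u t := by
  intro t ht
  have := exit_le (u := fun t => - u t) (u' := fun t => - u' t) (a := -a)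
    (fun t ht => (hd t ht).neg) (by linarith) (fun T hT h1 h2 => by
      have := h T hT (fun t ht => by linarith [h1 t ht]) (by linarith)
      linarith) t ht
  linarith

structure Prm where
  b : ℝ
  K : ℝ
  c : ℝ
  p : ℝ
  m : ℝ
  e : ℝ
  g : ℝ
  d : ℝ
  q : ℝ
  μ : ℝ
  α : ℝ
  P : ℝ
  hb : 0 < b
  hK : 0 < K
  hc : 0 < c
  hp : 0 < p
  hm : 0 < m
  he : 0 < e
  hg : 0 < g
  hd : 0 < d
  hq : 0 < q
  hμ : 0 < μ
  hα : 0 ≤ α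
  hP : 0 < P

namespace Prm
variable (z : Prm)

def fI (I F : ℝ) : ℝ := z.b * (1 - I / z.K) * F - z.c * I
def fY (I Y F : ℝ) : ℝ := z.p * I - z.m * Y + z.e * F
def sat (Y : ℝ) : ℝ := Y / (Y + z.P)
def dm (Y : ℝ) : ℝ := z.μ + z.α * z.P / (Y + z.P)
def fF (Y F M : ℝ) : ℝ := z.g * (M * z.sat Y) - z.d * F
def fM (I Y M : ℝ) : ℝ := z.q * I - z.dm Y * M

def iota (G : ℝ) : ℝ := z.b * G / (z.c + z.b * G / z.K)
def yh (G : ℝ) : ℝ := (z.p * z.iota G + z.e * G) / z.m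
def mh (G : ℝ) : ℝ := z.q * z.iota G / z.dm (z.yh G)
def Phi (G : ℝ) : ℝ := z.g * (z.mh G * z.sat (z.yh G)) / z.d

lemma den_pos {G : ℝ} (hG : 0 ≤ G) : 0 < z.c + z.b * G / z.K := by
  have := z.hb; have := z.hK; have := z.hc; positivity

lemma iota_nonneg {G : ℝ} (hG : 0 ≤ G) : 0 ≤ z.iota G :=
  div_nonneg (mul_nonneg z.hb.le hG) (z.den_pos hG).le

lemma yh_nonneg {G : ℝ} (hG : 0 ≤ G) : 0 ≤ z.yh G :=
  div_nonneg (add_nonneg (mul_nonneg z.hp.le (z.iota_nonneg hG)) (mul_nonneg z.he.le hG)) z.hm.le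

lemma dm_ge {Y : ℝ} (hY : 0 ≤ Y) : z.μ ≤ z.dm Y := by
  have := z.hα; have := z.hP
  have : 0 ≤ z.α * z.P / (Y + z.P) := by positivity
  unfold dm; linarith

lemma dm_pos {Y : ℝ} (hY : 0 ≤ Y) : 0 < z.dm Y := z.hμ.trans_le (z.dm_ge hY)

lemma dm_anti {Y Y' : ℝ} (hY : 0 ≤ Y) (h : Y ≤ Y') : z.dm Y' ≤ z.dm Y := by
  have := z.hα; have := z.hP
  unfold dm
  gcongr

lemma sat_nonneg {Y : ℝ} (hY : 0 ≤ Y) : 0 ≤ z.sat Y := by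
  have := z.hP
  unfold sat; positivity

lemma sat_le_one {Y : ℝ} (hY : 0 ≤ Y) : z.sat Y ≤ 1 := by
  have := z.hP
  unfold sat; rw [div_le_one (by positivity)]; linarith

lemma sat_mono {Y Y' : ℝ} (hY : 0 ≤ Y) (h : Y ≤ Y') : z.sat Y ≤ z.sat Y' := by
  have := z.hP
  unfold sat; rw [div_le_div_iff₀ (by linarith) (by linarith)]; nlinarith

lemma sat_lip {Y η : ℝ} (hY : 0 ≤ Y) (h : 0 ≤ η) : z.sat (Y + η) ≤ z.sat Y + η / z.P := by
  have hP := z.hP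
  have : z.sat (Y + η) - z.sat Y = η * z.P / ((Y + η + z.P) * (Y + z.P)) := by
    unfold sat
    have h1 : Y + η + z.P ≠ 0 := by positivity
    have h2 : Y + z.P ≠ 0 := by positivity
    field_simp; ring
  have h3 : η * z.P / ((Y + η + z.P) * (Y + z.P)) ≤ η / z.P := by
    rw [div_le_div_iff₀ (by positivity) hP]
    have : z.P * z.P ≤ (Y + η + z.P) * (Y + z.P) := by gcongr <;> linarith
    nlinarith
  linarith

lemma dm_eq {Y : ℝ} (hY : 0 ≤ Y) : z.dm Y = z.μ + z.α * (1 - z.sat Y) := by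
  have := z.hP
  have : Y + z.P ≠ 0 := by positivity
  unfold dm sat; field_simp; ring

lemma mh_nonneg {G : ℝ} (hG : 0 ≤ G) : 0 ≤ z.mh G :=
  div_nonneg (mul_nonneg z.hq.le (z.iota_nonneg hG)) (z.dm_pos (z.yh_nonneg hG)).le

lemma iota_eq {G : ℝ} (hG : 0 ≤ G) : z.fI (z.iota G) G = 0 := by
  have := (z.den_pos hG).ne'
  have := z.hK.ne'
  have h : z.iota G * (z.c + z.b * G / z.K) = z.b * G := by
    unfold iota; rw [div_mul_cancel₀ _ (z.den_pos hG).ne']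
  unfold fI
  have : z.b * (1 - z.iota G / z.K) * G - z.c * z.iota G
    = z.b * G - z.iota G * (z.c + z.b * G / z.K) := by ring
  linarith

lemma yh_eq (G : ℝ) : z.fY (z.iota G) (z.yh G) G = 0 := by
  have := z.hm.ne'
  unfold fY yh; field_simp; ring

lemma mh_eq {G : ℝ} (hG : 0 ≤ G) : z.fM (z.iota G) (z.yh G) (z.mh G) = 0 := by
  have := (z.dm_pos (z.yh_nonneg hG)).ne'
  unfold fM mh; field_simp; ring

lemma Phi_eq (G : ℝ) : z.fF (z.yh G) G (z.mh G) = z.d * (z.Phi G - G) := by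
  have := z.hd.ne'
  unfold fF Phi; field_simp

lemma fI_anti {I I' F : ℝ} (hF : 0 ≤ F) (h : I < I') : z.fI I' F < z.fI I F := by
  have h1 : z.fI I F - z.fI I' F = (z.c + z.b * F / z.K) * (I' - I) := by unfold fI; ring
  have := mul_pos (z.den_pos hF) (sub_pos.2 h)
  linarith

lemma iota_strict {G G' : ℝ} (hG : 0 ≤ G) (h : G < G') : z.iota G < z.iota G' := by
  have hb := z.hb; have hc := z.hc; have := z.hK
  unfold iota
  rw [div_lt_div_iff₀ (z.den_pos hG) (z.den_pos (hG.trans h.le))]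
  have : z.b * G' * (z.c + z.b * G / z.K) - z.b * G * (z.c + z.b * G' / z.K)
    = z.b * z.c * (G' - G) := by ring
  have := mul_pos (mul_pos hb hc) (sub_pos.2 h)
  linarith

lemma yh_strict {G G' : ℝ} (hG : 0 ≤ G) (h : G < G') : z.yh G < z.yh G' := by
  unfold yh
  have := z.hm
  have h1 := mul_lt_mul_of_pos_left (z.iota_strict hG h) z.hp
  have h2 := mul_lt_mul_of_pos_left h z.he
  gcongr

lemma mh_strict {G G' : ℝ} (hG : 0 ≤ G) (h : G < G') : z.mh G < z.mh G' := by
  unfold mh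
  have hG' := hG.trans h.le
  have h1 := z.dm_anti (z.yh_nonneg hG) (z.yh_strict hG h).le
  have h2 := z.dm_pos (z.yh_nonneg hG)
  have h3 := z.dm_pos (z.yh_nonneg hG')
  have h4 := mul_lt_mul_of_pos_left (z.iota_strict hG h) z.hq
  have h5 := mul_nonneg z.hq.le (z.iota_nonneg hG')
  calc _ < z.q * z.iota G' / z.dm (z.yh G) := by gcongr
    _ ≤ _ := by gcongr

lemma iota_lt_K {G : ℝ} (hG : 0 ≤ G) : z.iota G < z.K := by
  unfold iota
  rw [div_lt_iff₀ (z.den_pos hG)]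
  have := z.hK.ne'
  have : z.K * (z.c + z.b * G / z.K) = z.K * z.c + z.b * G := by field_simp
  have := mul_pos z.hK z.hc
  linarith

lemma iota_cont {G : ℝ} (hG : 0 ≤ G) : ContinuousAt z.iota G := by
  unfold iota
  exact ContinuousAt.div (by fun_prop) (by fun_prop) (z.den_pos hG).ne'

lemma yh_cont {G : ℝ} (hG : 0 ≤ G) : ContinuousAt z.yh G := by
  have := z.iota_cont hG
  unfold yh
  fun_prop

lemma mh_cont {G : ℝ} (hG : 0 ≤ G) : ContinuousAt z.mh G := by
  have h1 := z.iota_cont hG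
  have h2 := z.yh_cont hG
  unfold mh
  refine ContinuousAt.div (by fun_prop) ?_ (z.dm_pos (z.yh_nonneg hG)).ne'
  unfold dm
  refine continuousAt_const.add (ContinuousAt.div (by fun_prop) (by fun_prop) ?_)
  have := z.yh_nonneg hG
  have := z.hP
  positivity

@[simp] lemma iota_zero : z.iota 0 = 0 := by simp [iota]
@[simp] lemma yh_zero : z.yh 0 = 0 := by simp [yh]
@[simp] lemma mh_zero : z.mh 0 = 0 := by simp [mh]

lemma iota_pos {G : ℝ} (hG : 0 < G) : 0 < z.iota G := by
  have := z.iota_strict le_rfl hG; simpa using this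
lemma yh_pos {G : ℝ} (hG : 0 < G) : 0 < z.yh G := by
  have := z.yh_strict le_rfl hG; simpa using this
lemma mh_pos {G : ℝ} (hG : 0 < G) : 0 < z.mh G := by
  have := z.mh_strict le_rfl hG; simpa using this

/-- equilibria -/
lemma equil {I Y F M : ℝ} (hF : 0 ≤ F) (hY : 0 ≤ Y) (h0 : z.fI I F = 0)
    (h1 : z.fY I Y F = 0) (h2 : z.fF Y F M = 0) (h3 : z.fM I Y M = 0) :
    I = z.iota F ∧ Y = z.yh F ∧ M = z.mh F ∧ z.Phi F = F := by
  have hI : I = z.iota F := by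
    unfold iota
    rw [eq_div_iff (z.den_pos hF).ne']
    unfold fI at h0
    linear_combination -h0
  have hYe : Y = z.yh F := by
    unfold yh
    rw [eq_div_iff z.hm.ne', ← hI]
    unfold fY at h1
    linear_combination -h1
  have hMe : M = z.mh F := by
    unfold mh
    rw [← hI, ← hYe, eq_div_iff (z.dm_pos hY).ne']
    unfold fM at h3
    linear_combination -h3
  refine ⟨hI, hYe, hMe, ?_⟩
  rw [hYe, hMe, Phi_eq] at h2
  rcases mul_eq_zero.1 h2 with h | h
  · exact absurd h z.hd.ne'
  · linarith

/-- scalar polynomial -/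
def pol (u : ℝ) : ℝ := z.K * (1 - u) * (z.g * z.q * z.b * u - z.c * z.d * z.μ) *
    (z.p * z.b * u + z.e * z.c) - z.b * z.m * z.c * z.d * (z.μ + z.α) * z.P * u

def uu (G : ℝ) : ℝ := z.c * z.K / (z.c * z.K + z.b * G)

lemma Phi_pol {G : ℝ} (hG : 0 < G) : ∃ k > 0, z.Phi G - G = k * z.pol (z.uu G) := by
  have hb := z.hb; have hK := z.hK; have hc := z.hc; have hp := z.hp; have hm := z.hm
  have he := z.he; have hg := z.hg; have hd := z.hd; have hq := z.hq; have hμ := z.hμ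
  have hα := z.hα; have hP := z.hP
  have hden : 0 < z.c * z.K + z.b * G := by positivity
  have hu0 : 0 < z.uu G := by unfold uu; positivity
  have hI : z.iota G = z.b / z.c * z.uu G * G := by
    unfold iota uu
    have := z.den_pos hG.le
    field_simp
  have hGu : z.b * z.uu G * G = z.c * z.K * (1 - z.uu G) := by
    unfold uu; field_simp; ring
  have hY0 := z.yh_nonneg hG.le
  have hY : z.yh G * (z.b * z.m * z.uu G) = z.K * (1 - z.uu G) * (z.p * z.b * z.uu G + z.e * z.c) := by
    have h1 : z.yh G * (z.m * z.c) = G * (z.p * z.b * z.uu G + z.e * z.c) := by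
      unfold yh; rw [hI]; field_simp
    apply mul_right_cancel₀ hc.ne'
    linear_combination z.b * z.uu G * h1 + (z.p * z.b * z.uu G + z.e * z.c) * hGu
  set Y := z.yh G with hYd
  set u := z.uu G with hud
  have hden2 : 0 < z.μ * Y + (z.μ + z.α) * z.P := by positivity
  have hPhi : z.Phi G = z.g * z.q * (z.b / z.c * u * G) * Y / (z.d * (z.μ * Y + (z.μ + z.α) * z.P)) := by
    unfold Phi mh sat dm
    rw [hI, ← hYd]
    have h1 : Y + z.P ≠ 0 := by positivity
    have h2 : z.μ + z.α * z.P / (Y + z.P) = (z.μ * Y + (z.μ + z.α) * z.P) / (Y + z.P) := by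
      field_simp; ring
    rw [h2]
    field_simp
  refine ⟨G / (z.d * z.c * (z.μ * Y + (z.μ + z.α) * z.P) * (z.b * z.m * u)), by positivity, ?_⟩
  rw [hPhi]
  unfold pol
  have e1 : z.K * (1 - u) * (z.g * z.q * z.b * u - z.c * z.d * z.μ) * (z.p * z.b * u + z.e * z.c)
      = Y * (z.b * z.m * u) * (z.g * z.q * z.b * u - z.c * z.d * z.μ) := by rw [hY]; ring
  rw [e1]
  field_simp
  ring

end Prm

structure Sol (z : Prm) where
  I : ℝ → ℝ
  Y : ℝ → ℝ
  F : ℝ → ℝ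
  M : ℝ → ℝ
  dI : ∀ t, 0 ≤ t → HasDerivAt I (z.fI (I t) (F t)) t
  dY : ∀ t, 0 ≤ t → HasDerivAt Y (z.fY (I t) (Y t) (F t)) t
  dF : ∀ t, 0 ≤ t → HasDerivAt F (z.fF (Y t) (F t) (M t)) t
  dM : ∀ t, 0 ≤ t → HasDerivAt M (z.fM (I t) (Y t) (M t)) t
  nI : ∀ t, 0 ≤ t → 0 ≤ I t
  nY : ∀ t, 0 ≤ t → 0 ≤ Y t
  nF : ∀ t, 0 ≤ t → 0 ≤ F t
  nM : ∀ t, 0 ≤ t → 0 ≤ M t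

namespace Sol
variable {z : Prm} (s : Sol z)

lemma ev_I {G : ℝ} (hG : 0 ≤ G) (h : EvLe s.F G) : EvLe s.I (z.iota G) := by
  refine evle (C := z.b) (κ := z.c) s.dI z.hc ?_
  intro ε hε η hη _
  filter_upwards [h η hη, eventually_ge_atTop 0] with t hF ht hu
  have hF0 := s.nF t ht
  have hb := z.hb; have hK := z.hK; have hc := z.hc
  have hio := z.iota_nonneg hG
  have hbη : 0 < z.b * η := by positivity
  unfold Prm.fI
  by_cases hIK : s.I t ≤ z.K
  · have h1 : 0 ≤ 1 - s.I t / z.K := by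
      rw [sub_nonneg, div_le_one hK]; exact hIK
    have h2 : 1 - s.I t / z.K ≤ 1 := by
      have : 0 ≤ s.I t / z.K := div_nonneg (s.nI t ht) hK.le
      linarith
    have h3 : z.b * (1 - s.I t / z.K) * s.F t ≤ z.b * (1 - s.I t / z.K) * (G + η) := by
      gcongr
    have h4 := z.iota_eq hG
    have h5 : z.b * (1 - s.I t / z.K) * G ≤ z.b * (1 - z.iota G / z.K) * G := by
      gcongr; linarith
    have h6 : z.b * η * (1 - s.I t / z.K) ≤ z.b * η * 1 := by gcongr
    have h7 : z.c * (z.iota G + ε) ≤ z.c * s.I t := by gcongr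
    unfold Prm.fI at h4
    linarith
  · push Not at hIK
    have h1 : 1 - s.I t / z.K ≤ 0 := by
      rw [sub_nonpos, one_le_div hK]; exact hIK.le
    have h3 : z.b * (1 - s.I t / z.K) * s.F t ≤ 0 :=
      mul_nonpos_of_nonpos_of_nonneg (mul_nonpos_of_nonneg_of_nonpos hb.le h1) hF0
    have h7 : z.c * ε ≤ z.c * s.I t := by gcongr; linarith
    linarith

lemma ev_Y' {G I0 Y0 : ℝ} (h : EvLe s.F G) (hI : EvLe s.I I0)
    (h0 : z.m * Y0 = z.p * I0 + z.e * G) : EvLe s.Y Y0 := by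
  refine evle (C := z.p + z.e) (κ := z.m) s.dY z.hm ?_
  intro ε hε η hη _
  filter_upwards [h η hη, hI η hη] with t hF hI hu
  have h1 := mul_le_mul_of_nonneg_left hF z.he.le
  have h2 := mul_le_mul_of_nonneg_left hI z.hp.le
  have h3 := mul_le_mul_of_nonneg_left hu z.hm.le
  unfold Prm.fY
  linarith

lemma ev_M {G : ℝ} (hG : 0 ≤ G) (hI : EvLe s.I (z.iota G)) (hY : EvLe s.Y (z.yh G)) :
    EvLe s.M (z.mh G) := by
  have hm0 := z.mh_nonneg hG
  have hy0 := z.yh_nonneg hG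
  have hP := z.hP
  refine evle (C := z.q + z.α / z.P * z.mh G) (κ := z.μ) s.dM z.hμ ?_
  intro ε hε η hη _
  filter_upwards [hI η hη, hY η hη, eventually_ge_atTop 0] with t hI hY ht hu
  have hY0 := s.nY t ht
  have h1 : z.dm (z.yh G) - z.α / z.P * η ≤ z.dm (s.Y t) := by
    rw [z.dm_eq hy0, z.dm_eq hY0]
    have := z.sat_mono hY0 hY
    have := z.sat_lip hy0 hη.le
    have h3 : z.α * z.sat (s.Y t) ≤ z.α * (z.sat (z.yh G) + η / z.P) :=
      mul_le_mul_of_nonneg_left (by linarith) z.hα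
    have h4 : z.α * (z.sat (z.yh G) + η / z.P) = z.α * z.sat (z.yh G) + z.α / z.P * η := by
      field_simp
    linarith
  have h2 := z.dm_ge hY0
  have h3 := mul_le_mul_of_nonneg_left hI z.hq.le
  have h4 := z.mh_eq hG
  have h5 : z.dm (s.Y t) * (z.mh G + ε) ≤ z.dm (s.Y t) * s.M t :=
    mul_le_mul_of_nonneg_left hu (z.dm_pos hY0).le
  have h6 := mul_le_mul_of_nonneg_right h1 hm0
  have h7 := mul_le_mul_of_nonneg_right h2 hε.le
  unfold Prm.fM at *
  linarith

lemma ev_F {m0 s0 : ℝ} (hm0 : 0 ≤ m0) (hM : EvLe s.M m0)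
    (hS : ∀ η > 0, ∀ᶠ t in atTop, z.sat (s.Y t) ≤ s0 + η) :
    EvLe s.F (z.g * (m0 * s0) / z.d) := by
  refine evle (C := z.g * (m0 + 1)) (κ := z.d) s.dF z.hd ?_
  intro ε hε η hη _
  filter_upwards [hM η hη, hS η hη, eventually_ge_atTop 0] with t hM hS ht hu
  have hY0 := s.nY t ht
  have h1 := z.sat_le_one hY0
  have h0 := z.sat_nonneg hY0
  have h2 : s.M t * z.sat (s.Y t) ≤ (m0 + η) * z.sat (s.Y t) :=
    mul_le_mul_of_nonneg_right hM h0
  have h3 : m0 * z.sat (s.Y t) ≤ m0 * (s0 + η) := mul_le_mul_of_nonneg_left hS hm0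
  have h4 : η * z.sat (s.Y t) ≤ η * 1 := mul_le_mul_of_nonneg_left h1 hη.le
  have h5 : z.g * (s.M t * z.sat (s.Y t)) ≤ z.g * (m0 * s0 + (m0 + 1) * η) :=
    mul_le_mul_of_nonneg_left (by linarith) z.hg.le
  have h6 := mul_le_mul_of_nonneg_left hu z.hd.le
  have h7 : z.d * (z.g * (m0 * s0) / z.d) = z.g * (m0 * s0) := by
    have := z.hd.ne'; field_simp
  unfold Prm.fF
  linarith

lemma ev_all {G : ℝ} (hG : 0 ≤ G) (h : EvLe s.F G) :
    EvLe s.I (z.iota G) ∧ EvLe s.Y (z.yh G) ∧ EvLe s.M (z.mh G) ∧ EvLe s.F (z.Phi G) := by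
  have hI := s.ev_I hG h
  have hY : EvLe s.Y (z.yh G) := s.ev_Y' h hI (by
    have := z.yh_eq G
    unfold Prm.fY at this
    linarith)
  have hM := s.ev_M hG hI hY
  refine ⟨hI, hY, hM, ?_⟩
  have hy0 := z.yh_nonneg hG
  refine s.ev_F (z.mh_nonneg hG) hM ?_
  intro η hη
  have hP := z.hP
  filter_upwards [hY (η * z.P) (by positivity), eventually_ge_atTop 0] with t hY ht
  have h1 := z.sat_mono (s.nY t ht) hY
  have h2 := z.sat_lip hy0 (show 0 ≤ η * z.P by positivity)
  have : η * z.P / z.P = η := by field_simp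
  linarith

lemma ev_bdd : ∃ G, 0 ≤ G ∧ EvLe s.F G := by
  have hc := z.hc; have hK := z.hK; have hb := z.hb; have hq := z.hq; have hμ := z.hμ
  have hg := z.hg; have hd := z.hd
  have hI : EvLe s.I z.K := by
    refine evle (C := 0) (κ := z.c) s.dI z.hc ?_
    intro ε hε η hη _
    filter_upwards [eventually_ge_atTop 0] with t ht hu
    have hF0 := s.nF t ht
    unfold Prm.fI
    have h1 : 1 - s.I t / z.K ≤ 0 := by
      rw [sub_nonpos, one_le_div hK]; linarith
    have h3 : z.b * (1 - s.I t / z.K) * s.F t ≤ 0 :=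
      mul_nonpos_of_nonpos_of_nonneg (mul_nonpos_of_nonneg_of_nonpos hb.le h1) hF0
    have h7 : z.c * ε ≤ z.c * s.I t := by gcongr; linarith
    linarith
  have hM : EvLe s.M (z.q * z.K / z.μ) := by
    refine evle (C := z.q) (κ := z.μ) s.dM z.hμ ?_
    intro ε hε η hη _
    filter_upwards [hI η hη, eventually_ge_atTop 0] with t hI ht hu
    have h1 := mul_le_mul_of_nonneg_left hI hq.le
    have h2 := mul_le_mul_of_nonneg_right (z.dm_ge (s.nY t ht)) (s.nM t ht)
    have h3 := mul_le_mul_of_nonneg_left hu hμ.le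
    have h7 : z.μ * (z.q * z.K / z.μ) = z.q * z.K := by field_simp
    unfold Prm.fM
    linarith
  refine ⟨z.g * (z.q * z.K / z.μ * 1) / z.d, by positivity,
    s.ev_F (by positivity) hM ?_⟩
  intro η hη
  filter_upwards [eventually_ge_atTop 0] with t ht
  have := z.sat_le_one (s.nY t ht)
  linarith

/-- The minimal eventual bound. -/
lemma ev_min {G0 : ℝ} (hG0 : 0 ≤ G0) (h : EvLe s.F G0) :
    ∃ G, 0 ≤ G ∧ G ≤ G0 ∧ EvLe s.F G ∧ G ≤ z.Phi G := by
  set S := {G : ℝ | 0 ≤ G ∧ EvLe s.F G} with hS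
  have hSb : BddBelow S := ⟨0, fun x hx => hx.1⟩
  have hSn : S.Nonempty := ⟨G0, hG0, h⟩
  have hmin : EvLe s.F (sInf S) := by
    intro ε hε
    obtain ⟨x, hxS, hx⟩ := exists_lt_of_csInf_lt hSn (show sInf S < sInf S + ε / 2 by linarith)
    filter_upwards [hxS.2 (ε / 2) (by linarith)] with t ht
    linarith
  have h0 : 0 ≤ sInf S := le_csInf hSn fun x hx => hx.1
  refine ⟨sInf S, h0, csInf_le hSb ⟨hG0, h⟩, hmin, csInf_le hSb ⟨?_, (s.ev_all h0 hmin).2.2.2⟩⟩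
  unfold Prm.Phi
  exact div_nonneg (mul_nonneg z.hg.le (mul_nonneg (z.mh_nonneg h0)
    (z.sat_nonneg (z.yh_nonneg h0)))) z.hd.le

lemma up_step {G T : ℝ} (hG : 0 ≤ G) (hF : ∀ t ∈ Icc 0 T, s.F t ≤ G)
    (hI0 : s.I 0 ≤ z.iota G) (hY0 : s.Y 0 ≤ z.yh G) (hM0 : s.M 0 ≤ z.mh G) :
    ∀ t ∈ Icc 0 T, s.I t ≤ z.iota G ∧ s.Y t ≤ z.yh G ∧ s.M t ≤ z.mh G := by
  have hb := z.hb; have hK := z.hK; have hc := z.hc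
  have hI : ∀ t ∈ Icc 0 T, s.I t ≤ z.iota G := by
    refine weak (fun t ht => s.dI t ht.1) ?_ hI0
    intro t ht hu
    have hF1 := hF t ht
    have hF0 := s.nF t ht.1
    by_cases hIK : s.I t ≤ z.K
    · have h1 : 0 ≤ 1 - s.I t / z.K := by
        rw [sub_nonneg, div_le_one hK]; exact hIK
      have h3 : z.b * (1 - s.I t / z.K) * s.F t ≤ z.b * (1 - s.I t / z.K) * G := by
        gcongr
      have h4 := z.iota_eq hG
      have h5 := z.fI_anti hG hu
      unfold Prm.fI at *
      linarith
    · push Not at hIK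
      have h1 : 1 - s.I t / z.K ≤ 0 := by
        rw [sub_nonpos, one_le_div hK]; exact hIK.le
      have h3 : z.b * (1 - s.I t / z.K) * s.F t ≤ 0 :=
        mul_nonpos_of_nonpos_of_nonneg (mul_nonpos_of_nonneg_of_nonpos hb.le h1) hF0
      have h7 := mul_nonneg hc.le (s.nI t ht.1)
      unfold Prm.fI
      linarith
  have hY : ∀ t ∈ Icc 0 T, s.Y t ≤ z.yh G := by
    refine weak (fun t ht => s.dY t ht.1) ?_ hY0
    intro t ht hu
    have h1 := mul_le_mul_of_nonneg_left (hF t ht) z.he.le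
    have h2 := mul_le_mul_of_nonneg_left (hI t ht) z.hp.le
    have h3 := mul_le_mul_of_nonneg_left hu.le z.hm.le
    have h4 := z.yh_eq G
    unfold Prm.fY at *
    linarith
  refine fun t ht => ⟨hI t ht, hY t ht, ?_⟩
  refine weak (s := 0) (T := T) (fun t ht => s.dM t ht.1) ?_ hM0 t ht
  intro t ht hu
  have h1 := z.dm_anti (s.nY t ht.1) (hY t ht)
  have h2 := mul_le_mul_of_nonneg_left (hI t ht) z.hq.le
  have h3 := mul_le_mul_of_nonneg_left hu.le (z.dm_pos (s.nY t ht.1)).le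
  have h5 := mul_le_mul_of_nonneg_right h1 (z.mh_nonneg hG)
  have h4 := z.mh_eq hG
  unfold Prm.fM at *
  linarith

lemma up_inv {G : ℝ} (hG : 0 ≤ G) (hPhi : z.Phi G < G) (hF0 : s.F 0 ≤ G)
    (hI0 : s.I 0 ≤ z.iota G) (hY0 : s.Y 0 ≤ z.yh G) (hM0 : s.M 0 ≤ z.mh G) :
    ∀ t, 0 ≤ t → s.F t ≤ G ∧ s.I t ≤ z.iota G ∧ s.Y t ≤ z.yh G ∧ s.M t ≤ z.mh G := by
  have hF : ∀ t, 0 ≤ t → s.F t ≤ G := by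
    refine exit_le s.dF hF0 ?_
    intro T hT hall hFT
    obtain ⟨hI, hY, hM⟩ := s.up_step hG hall hI0 hY0 hM0 T (right_mem_Icc.2 hT)
    have h1 := z.sat_mono (s.nY T hT) hY
    have h2 : s.M T * z.sat (s.Y T) ≤ z.mh G * z.sat (z.yh G) :=
      mul_le_mul hM h1 (z.sat_nonneg (s.nY T hT)) (z.mh_nonneg hG)
    have h3 := mul_le_mul_of_nonneg_left h2 z.hg.le
    have h4 := z.Phi_eq G
    have h5 := mul_neg_of_pos_of_neg z.hd (sub_neg.2 hPhi)
    rw [hFT]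
    unfold Prm.fF at *
    linarith
  intro t ht
  exact ⟨hF t ht, s.up_step hG (fun t ht => hF t ht.1) hI0 hY0 hM0 t (right_mem_Icc.2 ht)⟩

lemma low_step {G T : ℝ} (hG : 0 ≤ G) (hF : ∀ t ∈ Icc 0 T, G ≤ s.F t)
    (hI0 : z.iota G ≤ s.I 0) (hY0 : z.yh G ≤ s.Y 0) (hM0 : z.mh G ≤ s.M 0) :
    ∀ t ∈ Icc 0 T, z.iota G ≤ s.I t ∧ z.yh G ≤ s.Y t ∧ z.mh G ≤ s.M t := by
  have hb := z.hb; have hK := z.hK; have hc := z.hc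
  have hI : ∀ t ∈ Icc 0 T, z.iota G ≤ s.I t := by
    refine weak_lower (fun t ht => s.dI t ht.1) ?_ hI0
    intro t ht hu
    have hF1 := hF t ht
    have hIK := z.iota_lt_K hG
    have h1 : 0 ≤ 1 - s.I t / z.K := by
      rw [sub_nonneg, div_le_one hK]; linarith
    have h3 : z.b * (1 - s.I t / z.K) * G ≤ z.b * (1 - s.I t / z.K) * s.F t := by
      gcongr
    have h4 := z.iota_eq hG
    have h5 := z.fI_anti hG hu
    unfold Prm.fI at *
    linarith
  have hY : ∀ t ∈ Icc 0 T, z.yh G ≤ s.Y t := by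
    refine weak_lower (fun t ht => s.dY t ht.1) ?_ hY0
    intro t ht hu
    have h1 := mul_le_mul_of_nonneg_left (hF t ht) z.he.le
    have h2 := mul_le_mul_of_nonneg_left (hI t ht) z.hp.le
    have h3 := mul_le_mul_of_nonneg_left hu.le z.hm.le
    have h4 := z.yh_eq G
    unfold Prm.fY at *
    linarith
  refine fun t ht => ⟨hI t ht, hY t ht, ?_⟩
  refine weak_lower (s := 0) (T := T) (fun t ht => s.dM t ht.1) ?_ hM0 t ht
  intro t ht hu
  have h1 := z.dm_anti (z.yh_nonneg hG) (hY t ht)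
  have h2 := mul_le_mul_of_nonneg_left (hI t ht) z.hq.le
  have h3 := mul_le_mul_of_nonneg_left hu.le (z.dm_pos (s.nY t ht.1)).le
  have h5 := mul_le_mul_of_nonneg_right h1 (z.mh_nonneg hG)
  have h4 := z.mh_eq hG
  unfold Prm.fM at *
  linarith

lemma low_inv {G : ℝ} (hG : 0 ≤ G) (hPhi : G < z.Phi G) (hF0 : G ≤ s.F 0)
    (hI0 : z.iota G ≤ s.I 0) (hY0 : z.yh G ≤ s.Y 0) (hM0 : z.mh G ≤ s.M 0) :
    ∀ t, 0 ≤ t → G ≤ s.F t := by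
  refine exit_ge s.dF hF0 ?_
  intro T hT hall hFT
  obtain ⟨hI, hY, hM⟩ := s.low_step hG hall hI0 hY0 hM0 T (right_mem_Icc.2 hT)
  have h1 := z.sat_mono (z.yh_nonneg hG) hY
  have h2 : z.mh G * z.sat (z.yh G) ≤ s.M T * z.sat (s.Y T) :=
    mul_le_mul hM h1 (z.sat_nonneg (z.yh_nonneg hG)) (s.nM T hT)
  have h3 := mul_le_mul_of_nonneg_left h2 z.hg.le
  have h4 := z.Phi_eq G
  have h5 := mul_pos z.hd (sub_pos.2 hPhi)
  rw [hFT]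
  unfold Prm.fF at *
  linarith

end Sol

lemma EvLe.tendsto {u : ℝ → ℝ} {a : ℝ} (h : EvLe u a) (h2 : ∀ t, 0 ≤ t → a ≤ u t) :
    Tendsto u atTop (𝓝 a) := by
  rw [Metric.tendsto_atTop']
  intro ε hε
  obtain ⟨T, hT⟩ := eventually_atTop.1 (h (ε / 2) (by linarith))
  refine ⟨max T 0, fun t ht => ?_⟩
  have h3 := hT t ((le_max_left _ _).trans ht.le)
  have h4 := h2 t ((le_max_right _ _).trans ht.le)
  rw [Real.dist_eq, abs_lt]
  constructor <;> linarith

namespace Sol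
variable {z : Prm} (s : Sol z)

/-- all components converge to the curve point of parameter `G` -/
def Conv (G : ℝ) : Prop := Tendsto s.I atTop (𝓝 (z.iota G)) ∧ Tendsto s.Y atTop (𝓝 (z.yh G)) ∧
  Tendsto s.F atTop (𝓝 G) ∧ Tendsto s.M atTop (𝓝 (z.mh G))

lemma conv_zero {G0 : ℝ} (hG0 : 0 ≤ G0) (h : EvLe s.F G0)
    (hP : ∀ G, 0 < G → G ≤ G0 → z.Phi G < G) : s.Conv 0 := by
  obtain ⟨G, hG, hGG, hev, hle⟩ := s.ev_min hG0 h
  have : G = 0 := by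
    rcases hG.eq_or_lt with h1 | h1
    · exact h1.symm
    · linarith [hP G h1 hGG]
  subst this
  obtain ⟨a1, a2, a3, a4⟩ := s.ev_all le_rfl hev
  refine ⟨a1.tendsto ?_, a2.tendsto ?_, hev.tendsto s.nF, a3.tendsto ?_⟩
  · simpa using s.nI
  · simpa using s.nY
  · simpa using s.nM

lemma conv_E2 {G1 G2 : ℝ} (hG1 : 0 ≤ G1) (h12 : G1 < G2)
    (hP : ∀ G, G2 < G → z.Phi G < G) (hP' : ∀ G, G1 < G → G < G2 → G < z.Phi G)
    (hI0 : z.iota G2 ≤ s.I 0) (hY0 : z.yh G2 ≤ s.Y 0) (hF0 : G2 ≤ s.F 0) (hM0 : z.mh G2 ≤ s.M 0) :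
    s.Conv G2 := by
  have hG2 : 0 ≤ G2 := hG1.trans h12.le
  have hF : ∀ t, 0 ≤ t → G2 ≤ s.F t := by
    intro t ht
    by_contra hc
    push Not at hc
    obtain ⟨G, hGa, hGb⟩ := exists_between (max_lt h12 hc)
    have ha := (le_max_left _ _).trans_lt hGa
    have hb := (le_max_right _ _).trans_lt hGa
    have h0 : 0 ≤ G := hG1.trans ha.le
    have := s.low_inv h0 (hP' G ha hGb) (hGb.le.trans hF0) ((z.iota_strict h0 hGb).le.trans hI0)
      ((z.yh_strict h0 hGb).le.trans hY0) ((z.mh_strict h0 hGb).le.trans hM0) t ht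
    linarith
  obtain ⟨G0, hG0, hev0⟩ := s.ev_bdd
  obtain ⟨G, hG, hGG, hev, hle⟩ := s.ev_min hG0 hev0
  have hGle : G ≤ G2 := by
    by_contra hc
    push Not at hc
    linarith [hP G hc]
  have hev2 : EvLe s.F G2 := by
    intro ε hε
    filter_upwards [hev ε hε] with t ht
    linarith
  obtain ⟨a1, a2, a3, a4⟩ := s.ev_all hG2 hev2
  have hlow := fun (t : ℝ) (ht : 0 ≤ t) =>
    s.low_step hG2 (T := t) (fun t ht => hF t ht.1) hI0 hY0 hM0 t (right_mem_Icc.2 ht)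
  exact ⟨a1.tendsto fun t ht => (hlow t ht).1, a2.tendsto fun t ht => (hlow t ht).2.1,
    hev2.tendsto hF, a3.tendsto fun t ht => (hlow t ht).2.2⟩

end Sol

namespace Prm
variable (z : Prm)

def setP (P : ℝ) (hP : 0 < P) : Prm := { z with P := P, hP := hP }

def qol (u : ℝ) : ℝ := z.K * (1 - u) * (z.g * z.q * z.b * u - z.c * z.d * z.μ) *
    (z.p * z.b * u + z.e * z.c)

def cc : ℝ := z.b * z.m * z.c * z.d * (z.μ + z.α)

lemma cc_pos : 0 < z.cc := by
  have hb := z.hb; have hc := z.hc; have hm := z.hm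
  have hd := z.hd; have hμ := z.hμ; have hα := z.hα
  unfold cc; positivity

lemma setP_pol (P : ℝ) (hP : 0 < P) (u : ℝ) : (z.setP P hP).pol u = z.qol u - z.cc * P * u := rfl

lemma cubic_factor {p3 p2 p1 p0 x y : ℝ} (h0 : 0 < p0) (hx : 0 < x) (hxy : x < y)
    (h1 : -p3 * x ^ 3 + p2 * x ^ 2 + p1 * x - p0 = 0)
    (h2 : -p3 * y ^ 3 + p2 * y ^ 2 + p1 * y - p0 = 0) :
    ∃ w > 0, ∀ u, -p3 * u ^ 3 + p2 * u ^ 2 + p1 * u - p0 = (u - x) * (y - u) * (p3 * u + w) := by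
  have hy : 0 < y := hx.trans hxy
  have e1 : p1 = p3 * (x ^ 2 + x * y + y ^ 2) - p2 * (x + y) := by
    have : y - x ≠ 0 := by linarith
    apply mul_left_cancel₀ this
    linear_combination h2 - h1
  have e0 : p0 = x * y * (p3 * (x + y) - p2) := by
    rw [e1] at h1; linear_combination -h1
  refine ⟨p3 * (x + y) - p2, ?_, ?_⟩
  · rw [e0] at h0
    exact pos_of_mul_pos_right h0 (by positivity)
  · intro u
    rw [e0, e1]; ring

lemma threshold (hAB : z.c * z.d * z.μ < z.g * z.q * z.b) :
    ∃ T > 0, (∀ P, T < P → ∀ u, 0 < u → u ≤ 1 → z.qol u - z.cc * P * u < 0) ∧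
      (∀ P, 0 < P → P < T → ∃ x y p3 w, 0 < x ∧ x < y ∧ y < 1 ∧ 0 < p3 ∧ 0 < w ∧
        ∀ u, z.qol u - z.cc * P * u = (u - x) * (y - u) * (p3 * u + w)) := by
  have hb := z.hb; have hK := z.hK; have hc := z.hc; have hp := z.hp; have hm := z.hm
  have he := z.he; have hg := z.hg; have hd := z.hd; have hq := z.hq; have hμ := z.hμ
  have hcc := z.cc_pos
  set A := z.g * z.q * z.b with hA
  set B := z.c * z.d * z.μ with hB
  have hB0 : 0 < B := by positivity
  have hA0 : 0 < A := by positivity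
  have hu1 : 0 < B / A := by positivity
  have hu1' : B / A < 1 := by rw [div_lt_one hA0]; exact hAB
  have hqc : Continuous z.qol := by unfold qol; fun_prop
  have hcont : ContinuousOn (fun u => z.qol u / (z.cc * u)) (Icc (B / A) 1) := by
    refine ContinuousOn.div hqc.continuousOn (by fun_prop) ?_
    intro u hu
    have : 0 < u := hu1.trans_le hu.1
    positivity
  have hqpos : ∀ u, B / A < u → u < 1 → 0 < z.qol u := by
    intro u h1 h2
    have h3 : 0 < u := hu1.trans h1
    have h4 : 0 < A * u - B := by
      rw [div_lt_iff₀ hA0] at h1; linarith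
    have h5 : 0 < 1 - u := by linarith
    unfold qol
    rw [← hA, ← hB]
    positivity
  have hqneg : ∀ u, 0 < u → u ≤ B / A → z.qol u ≤ 0 := by
    intro u h1 h2
    have h4 : A * u - B ≤ 0 := by
      rw [le_div_iff₀ hA0] at h2; linarith
    have h5 : 0 ≤ 1 - u := by linarith
    unfold qol
    rw [← hA, ← hB]
    exact mul_nonpos_of_nonpos_of_nonneg (mul_nonpos_of_nonneg_of_nonpos (by positivity) h4)
      (by positivity)
  obtain ⟨v, hv, hmax⟩ := isCompact_Icc.exists_isMaxOn (nonempty_Icc.2 hu1'.le) hcont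
  have hmax' : ∀ u ∈ Icc (B / A) 1, z.qol u / (z.cc * u) ≤ z.qol v / (z.cc * v) := hmax
  have hv0 : 0 < v := hu1.trans_le hv.1
  have hT : 0 < z.qol v / (z.cc * v) := by
    have h1 : B / A < (B / A + 1) / 2 := by linarith
    have h2 : (B / A + 1) / 2 < 1 := by linarith
    have := hqpos _ h1 h2
    refine lt_of_lt_of_le ?_ (hmax' ((B / A + 1) / 2) ⟨h1.le, h2.le⟩)
    positivity
  refine ⟨_, hT, ?_, ?_⟩
  · intro P hP u hu hu1
    by_cases h : B / A ≤ u
    · have h1 := (hmax' u ⟨h, hu1⟩).trans_lt hP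
      rw [div_lt_iff₀ (by positivity)] at h1
      linarith
    · push Not at h
      have h1 := hqneg u hu h.le
      have : 0 < P := hT.trans hP
      have : 0 < z.cc * P * u := by positivity
      linarith
  · intro P hP hPT
    set f : ℝ → ℝ := fun u => z.qol u - z.cc * P * u with hf
    have hfc : Continuous f := by fun_prop
    have hfv : 0 < f v := by
      rw [lt_div_iff₀ (by positivity)] at hPT
      simp only [hf]; linarith
    have hf1 : f 1 < 0 := by
      have : 0 < z.cc * P := by positivity
      simp only [hf, qol]; simp; linarith
    have hfb : f (B / A) < 0 := by
      have h1 := hqneg _ hu1 le_rfl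
      have : 0 < z.cc * P * (B / A) := by positivity
      simp only [hf]; linarith
    obtain ⟨x, hx, hfx⟩ := intermediate_value_Ioo hv.1 hfc.continuousOn ⟨hfb, hfv⟩
    obtain ⟨y, hy, hfy⟩ := intermediate_value_Ioo' hv.2 hfc.continuousOn ⟨hf1, hfv⟩
    have hexp : ∀ u, f u = -(z.K * A * (z.p * z.b)) * u ^ 3 +
        (z.K * ((A + B) * (z.p * z.b) - A * (z.e * z.c))) * u ^ 2 +
        (z.K * ((A + B) * (z.e * z.c) - B * (z.p * z.b)) - z.cc * P) * u
        - z.K * B * (z.e * z.c) := by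
      intro u
      simp only [hf, qol]
      rw [← hA, ← hB]
      ring
    have hx0 : 0 < x := hu1.trans hx.1
    obtain ⟨w, hw, hall⟩ := cubic_factor (by positivity : 0 < z.K * B * (z.e * z.c)) hx0
      (hx.2.trans hy.1) ((hexp x).symm.trans hfx) ((hexp y).symm.trans hfy)
    refine ⟨x, y, z.K * A * (z.p * z.b), w, hx0, hx.2.trans hy.1, hy.2, by positivity, hw, ?_⟩
    intro u
    rw [← hall u, ← hexp u]

def gg (u : ℝ) : ℝ := z.c * z.K * (1 - u) / (z.b * u)

lemma uu_pos {G : ℝ} (hG : 0 < G) : 0 < z.uu G := by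
  have hb := z.hb; have hK := z.hK; have hc := z.hc
  unfold uu; positivity

lemma uu_le {G : ℝ} (hG : 0 < G) : z.uu G ≤ 1 := by
  have hb := z.hb; have hK := z.hK; have hc := z.hc
  unfold uu; rw [div_le_one (by positivity)]
  have : 0 < z.b * G := by positivity
  linarith

lemma uu_gt {G v : ℝ} (hG : 0 < G) (hv : 0 < v) : v < z.uu G ↔ G < z.gg v := by
  have hb := z.hb; have hK := z.hK; have hc := z.hc
  unfold uu gg
  rw [lt_div_iff₀ (by positivity), lt_div_iff₀ (by positivity)]
  constructor <;> intro h <;> linarith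

lemma uu_lt {G v : ℝ} (hG : 0 < G) (hv : 0 < v) : z.uu G < v ↔ z.gg v < G := by
  have hb := z.hb; have hK := z.hK; have hc := z.hc
  unfold uu gg
  rw [div_lt_iff₀ (by positivity), div_lt_iff₀ (by positivity)]
  constructor <;> intro h <;> linarith

lemma gg_pos {v : ℝ} (hv : 0 < v) (hv1 : v < 1) : 0 < z.gg v := by
  have hb := z.hb; have hK := z.hK; have hc := z.hc
  have : 0 < 1 - v := by linarith
  unfold gg; positivity

lemma uu_gg {v : ℝ} (hv : 0 < v) (hv1 : v < 1) : z.uu (z.gg v) = v := by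
  have hG := z.gg_pos hv hv1
  apply le_antisymm
  · by_contra h; push Not at h; exact lt_irrefl _ ((z.uu_gt hG hv).1 h)
  · by_contra h; push Not at h; exact lt_irrefl _ ((z.uu_lt hG hv).1 h)

lemma Phi_lt_iff {G : ℝ} (hG : 0 < G) : z.Phi G < G ↔ z.pol (z.uu G) < 0 := by
  obtain ⟨k, hk, h⟩ := z.Phi_pol hG
  rw [← sub_neg, h]
  exact ⟨fun h => neg_of_mul_neg_right h hk.le, fun h => mul_neg_of_pos_of_neg hk h⟩

lemma Phi_gt_iff {G : ℝ} (hG : 0 < G) : G < z.Phi G ↔ 0 < z.pol (z.uu G) := by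
  obtain ⟨k, hk, h⟩ := z.Phi_pol hG
  rw [← sub_pos, h]
  exact ⟨fun h => pos_of_mul_pos_right h hk.le, fun h => mul_pos hk h⟩

lemma Phi_eq_iff {G : ℝ} (hG : 0 < G) : z.Phi G = G ↔ z.pol (z.uu G) = 0 := by
  obtain ⟨k, hk, h⟩ := z.Phi_pol hG
  rw [← sub_eq_zero, h]
  simp [hk.ne']

lemma two_states {x y p3 w : ℝ} (hx : 0 < x) (hxy : x < y) (hy : y < 1) (h3 : 0 < p3) (hw : 0 < w)
    (h : ∀ u, z.pol u = (u - x) * (y - u) * (p3 * u + w)) :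
    ∃ G1 G2, 0 < G1 ∧ G1 < G2 ∧ z.Phi G1 = G1 ∧ z.Phi G2 = G2 ∧
      (∀ G, 0 < G → G < G1 → z.Phi G < G) ∧ (∀ G, G1 < G → G < G2 → G < z.Phi G) ∧
      (∀ G, G2 < G → z.Phi G < G) := by
  have hy0 := hx.trans hxy
  have hG1 := z.gg_pos hy0 hy
  have h12 : z.gg y < z.gg x := by
    rw [← z.uu_gt hG1 hx, z.uu_gg hy0 hy]; exact hxy
  refine ⟨z.gg y, z.gg x, hG1, h12, ?_, ?_, ?_, ?_, ?_⟩
  · rw [z.Phi_eq_iff hG1, z.uu_gg hy0 hy, h]; ring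
  · rw [z.Phi_eq_iff (hG1.trans h12), z.uu_gg hx (hxy.trans hy), h]; ring
  · intro G hG hlt
    rw [z.Phi_lt_iff hG, h]
    have h1 := (z.uu_gt hG hy0).2 hlt
    have h0 := z.uu_pos hG
    exact mul_neg_of_neg_of_pos (mul_neg_of_pos_of_neg (by linarith) (by linarith)) (by positivity)
  · intro G hlt hlt2
    have hG := hG1.trans hlt
    rw [z.Phi_gt_iff hG, h]
    have h1 := (z.uu_lt hG hy0).2 hlt
    have h2 := (z.uu_gt hG hx).2 hlt2
    have h0 := z.uu_pos hG
    exact mul_pos (mul_pos (by linarith) (by linarith)) (by positivity)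
  · intro G hlt
    have hG := (hG1.trans h12).trans hlt
    rw [z.Phi_lt_iff hG, h]
    have h1 := (z.uu_lt hG hx).2 hlt
    have h0 := z.uu_pos hG
    exact mul_neg_of_neg_of_pos (mul_neg_of_neg_of_pos (by linarith) (by linarith)) (by positivity)

def pt (G : ℝ) : Fin 4 → ℝ := ![z.iota G, z.yh G, G, z.mh G]

def vf : (Fin 4 → ℝ) → (Fin 4 → ℝ) := fun x =>
  ![z.fI (x 0) (x 2), z.fY (x 0) (x 1) (x 2), z.fF (x 1) (x 2) (x 3), z.fM (x 0) (x 1) (x 3)]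

def toSol {x : ℝ → Fin 4 → ℝ} (h : IsSolOn z.vf Orthant x) : Sol z where
  I := fun t => x t 0
  Y := fun t => x t 1
  F := fun t => x t 2
  M := fun t => x t 3
  dI := fun t ht => hasDerivAt_pi.1 (h.1 t ht) 0
  dY := fun t ht => hasDerivAt_pi.1 (h.1 t ht) 1
  dF := fun t ht => hasDerivAt_pi.1 (h.1 t ht) 2
  dM := fun t ht => hasDerivAt_pi.1 (h.1 t ht) 3
  nI := fun t ht => h.2 t ht 0
  nY := fun t ht => h.2 t ht 1
  nF := fun t ht => h.2 t ht 2
  nM := fun t ht => h.2 t ht 3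

lemma conv_pt {x : ℝ → Fin 4 → ℝ} (h : IsSolOn z.vf Orthant x) {G : ℝ}
    (hc : (z.toSol h).Conv G) : Tendsto x atTop (𝓝 (z.pt G)) := by
  rw [tendsto_pi_nhds]
  obtain ⟨h0, h1, h2, h3⟩ := hc
  intro i
  fin_cases i
  · exact h0
  · exact h1
  · exact h2
  · exact h3

lemma pt_zero : z.pt 0 = 0 := by
  ext i; fin_cases i <;> simp [pt]

lemma pt_pos {G : ℝ} (hG : 0 < G) : ∀ i, 0 < z.pt G i := by
  intro i
  fin_cases i
  · exact z.iota_pos hG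
  · exact z.yh_pos hG
  · exact hG
  · exact z.mh_pos hG

lemma pt_strict {G G' : ℝ} (hG : 0 ≤ G) (h : G < G') : ∀ i, z.pt G i < z.pt G' i := by
  intro i
  fin_cases i
  · exact z.iota_strict hG h
  · exact z.yh_strict hG h
  · exact h
  · exact z.mh_strict hG h

lemma pt_cont {G : ℝ} (hG : 0 ≤ G) : ContinuousAt z.pt G := by
  refine continuousAt_pi.2 ?_
  intro i
  fin_cases i
  · exact z.iota_cont hG
  · exact z.yh_cont hG
  · exact continuousAt_id
  · exact z.mh_cont hG

lemma vf_pt {G : ℝ} (hG : 0 ≤ G) (h : z.Phi G = G) : z.vf (z.pt G) = 0 := by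
  ext i
  fin_cases i
  · exact z.iota_eq hG
  · exact z.yh_eq G
  · exact (z.Phi_eq G).trans (by rw [h, sub_self, mul_zero]; rfl)
  · exact z.mh_eq hG

lemma eq_pt {x : Fin 4 → ℝ} (hx : x ∈ Orthant) (h : z.vf x = 0) :
    x = z.pt (x 2) ∧ z.Phi (x 2) = x 2 := by
  obtain ⟨a, b, c, d⟩ := z.equil (hx 2) (hx 1) (congrFun h 0) (congrFun h 1) (congrFun h 2)
    (congrFun h 3)
  refine ⟨?_, d⟩
  ext i
  fin_cases i
  · exact a
  · exact b
  · rfl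
  · exact c

lemma inv_pt {x : ℝ → Fin 4 → ℝ} (h : IsSolOn z.vf Orthant x) {G : ℝ} (hG : 0 ≤ G)
    (hP : z.Phi G < G) (h0 : ∀ i, x 0 i ≤ z.pt G i) : ∀ t, 0 ≤ t → ∀ i, x t i ≤ z.pt G i := by
  intro t ht i
  obtain ⟨a, b, c, d⟩ := (z.toSol h).up_inv hG hP (h0 2) (h0 0) (h0 1) (h0 3) t ht
  fin_cases i
  · exact b
  · exact c
  · exact a
  · exact d

lemma vf_zero : z.vf 0 = 0 := by
  have := z.vf_pt le_rfl (by simp [Phi])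
  rwa [z.pt_zero] at this

lemma gas (hP : ∀ G, 0 < G → z.Phi G < G) : GASOn z.vf Orthant 0 := by
  refine ⟨?_, ?_, ?_⟩
  · exact z.vf_zero
  · intro ε hε
    have hc : Tendsto z.pt (𝓝[>] 0) (𝓝 (z.pt 0)) :=
      (z.pt_cont le_rfl).tendsto.mono_left nhdsWithin_le_nhds
    obtain ⟨G, hG, hGpos⟩ := ((hc.eventually (Metric.ball_mem_nhds _ hε)).and
      self_mem_nhdsWithin).exists
    have hGpos : 0 < G := hGpos
    rw [z.pt_zero] at hG
    have hpos := z.pt_pos hGpos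
    obtain ⟨d, hd, hdl⟩ : ∃ d > 0, ∀ i, d ≤ z.pt G i := by
      obtain ⟨i, hi⟩ := Finite.exists_min (z.pt G)
      exact ⟨z.pt G i, hpos i, hi⟩
    refine ⟨d, hd, ?_⟩
    intro x hx hdist t ht
    have h0 : ∀ i, x 0 i ≤ z.pt G i := by
      intro i
      have h1 := (dist_pi_lt_iff hd).1 hdist i
      rw [Real.dist_eq] at h1
      have h2 := le_abs_self (x 0 i - (0 : Fin 4 → ℝ) i)
      simp only [Pi.zero_apply, sub_zero] at h1 h2
      linarith [hdl i]
    have h1 := z.inv_pt hx hGpos.le (hP G hGpos) h0 t ht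
    rw [dist_pi_lt_iff hε]
    intro i
    have h2 := (dist_pi_lt_iff hε).1 hG i
    have h3 := hx.2 t ht i
    simp only [Pi.zero_apply, Real.dist_eq, sub_zero] at h2 ⊢
    rw [abs_of_nonneg h3]
    exact (h1 i).trans_lt ((le_abs_self _).trans_lt h2)
  · intro x hx
    rw [← z.pt_zero]
    apply z.conv_pt hx
    obtain ⟨G0, hG0, h⟩ := (z.toSol hx).ev_bdd
    exact (z.toSol hx).conv_zero hG0 h fun G hG _ => hP G hG

lemma bistable {G1 G2 : ℝ} (hG1 : 0 < G1) (h12 : G1 < G2) (hP1 : z.Phi G1 = G1)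
    (hP2 : z.Phi G2 = G2) (ha : ∀ G, 0 < G → G < G1 → z.Phi G < G)
    (hb : ∀ G, G1 < G → G < G2 → G < z.Phi G) (hc : ∀ G, G2 < G → z.Phi G < G) :
    ∃ E1 E2 : Fin 4 → ℝ,
      (∀ i, 0 < E1 i) ∧ (∀ i, 0 < E2 i) ∧ (∀ i, E1 i < E2 i) ∧
      {x ∈ Orthant | z.vf x = 0} = {0, E1, E2} ∧
      (∀ x : ℝ → Fin 4 → ℝ, IsSolOn z.vf Orthant x →
        (∀ i, x 0 i < E1 i) → Tendsto x atTop (𝓝 0)) ∧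
      (∀ x : ℝ → Fin 4 → ℝ, IsSolOn z.vf Orthant x →
        (∀ i, E2 i ≤ x 0 i) → x 0 0 ≤ z.K → Tendsto x atTop (𝓝 E2)) := by
  have hG2 := hG1.trans h12
  refine ⟨z.pt G1, z.pt G2, z.pt_pos hG1, z.pt_pos hG2, z.pt_strict hG1.le h12, ?_, ?_, ?_⟩
  · ext x
    simp only [mem_ofPred_eq, mem_insert_iff, mem_singleton_iff]
    constructor
    · rintro ⟨hx, hfx⟩
      obtain ⟨h1, h2⟩ := z.eq_pt hx hfx
      set G := x 2
      have hG : 0 ≤ G := hx 2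
      rcases hG.eq_or_lt with h | h
      · left; rw [h1, ← h, z.pt_zero]
      rcases lt_trichotomy G G1 with h3 | h3 | h3
      · linarith [ha G h h3]
      · right; left; rw [h1, h3]
      rcases lt_trichotomy G G2 with h4 | h4 | h4
      · linarith [hb G h3 h4]
      · right; right; rw [h1, h4]
      · linarith [hc G h4]
    · rintro (h | h | h)
      · rw [h]
        exact ⟨fun i => le_rfl, z.vf_zero⟩
      · rw [h]
        exact ⟨fun i => (z.pt_pos hG1 i).le, z.vf_pt hG1.le hP1⟩
      · rw [h]
        exact ⟨fun i => (z.pt_pos hG2 i).le, z.vf_pt hG2.le hP2⟩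
  · intro x hx h0
    have hcont : Tendsto z.pt (𝓝[<] G1) (𝓝 (z.pt G1)) :=
      (z.pt_cont hG1.le).tendsto.mono_left nhdsWithin_le_nhds
    have hev : ∀ᶠ G in 𝓝[<] G1, ∀ i, x 0 i < z.pt G i := by
      rw [eventually_all]
      intro i
      exact ((tendsto_pi_nhds.1 hcont) i).eventually (lt_mem_nhds (h0 i))
    obtain ⟨G, hG, hGI⟩ := (hev.and (Ioo_mem_nhdsLT hG1)).exists
    have hinv := z.inv_pt hx hGI.1.le (ha G hGI.1 hGI.2) fun i => (hG i).le
    rw [← z.pt_zero]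
    apply z.conv_pt hx
    refine (z.toSol hx).conv_zero hGI.1.le ?_ fun G' h1 h2 => ha G' h1 (h2.trans_lt hGI.2)
    intro ε hε
    filter_upwards [eventually_ge_atTop 0] with t ht
    have : x t 2 ≤ G := hinv t ht 2
    show x t 2 ≤ G + ε
    linarith
  · intro x hx h0 _
    apply z.conv_pt hx
    exact (z.toSol hx).conv_E2 hG1.le h12 hc hb (h0 0) (h0 1) (h0 2) (h0 3)

end Prm

/-- For the auxiliary monotone system there exists a threshold `Ỹ_P** > 0` (the tangency
value for `I·ξ(I)·φ̃(I) = η(Y_P, I)` on `(0, I₁)`) such that: (i) for `Y_P > Ỹ_P**`,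
`TE` is globally asymptotically stable on ℝ⁴₊; (ii) for `0 < Y_P < Ỹ_P**` the system has
exactly three equilibria `TE < Ẽ⁽¹⁾ < Ẽ⁽²⁾`, the basin of attraction of `TE` contains
`{x ∈ ℝ⁴₊ : 0 ≤ x < Ẽ⁽¹⁾}` and the basin of `Ẽ⁽²⁾` contains
`{x ∈ ℝ⁴₊ : x ≥ Ẽ⁽²⁾, I ≤ K}`. -/
theorem auxiliaryMonotoneSystem_threshold
    (b K γ r νI μI νY μY δ μF μM α N0 Istar Ystar Mstar I1 : ℝ)
    (hb : 0 < b) (hK : 0 < K) (hγ : 0 < γ) (hr : 0 < r) (hr1 : r < 1)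
    (hνI : 0 < νI) (hμI : 0 < μI) (hνY : 0 < νY) (hμY : 0 < μY)
    (hδ : 0 < δ) (hμF : 0 < μF) (hμM : 0 < μM) (hα : 0 ≤ α)
    (hN0 : N0 = b * r * νI * νY / ((μI + νI) * ((νY + μY) * (δ + μF) - δ * νY)))
    (hgt : 1 < N0)
    (hIs : Istar = (1 - 1 / N0) * K)
    (hYs : Ystar = r * νI * (δ + μF) * Istar / ((νY + μY) * (δ + μF) - δ * νY))
    (hMs : Mstar = (1 - r) * νI * Istar / μM)
    (habund : Ystar < γ * Mstar)
    (hI1 : I1 = K * (1 - (δ + μF) * (νI + μI) * μM / (νY * γ * (1 - r) * νI * b))) :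
    ∃ Ytss : ℝ, 0 < Ytss ∧
      (∀ YP : ℝ, Ytss < YP →
        (∀ I ∈ Ioo (0 : ℝ) I1,
          I * (νY * γ * (1 - r) * νI * b * (1 - I / K) - (δ + μF) * (νI + μI) * μM) *
              (r * νI * b * (1 - I / K) + δ * (νI + μI)) ≠
            μY * (δ + μF) * (νI + μI) * (μM + α) * b * (1 - I / K) * YP) ∧
        GASOn (auxMono b K γ r νI μI νY μY δ μF μM α YP) Orthant 0) ∧
      (∀ YP : ℝ, 0 < YP → YP < Ytss →
        ∃ E1 E2 : Fin 4 → ℝ,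
          (∀ i, 0 < E1 i) ∧ (∀ i, 0 < E2 i) ∧ (∀ i, E1 i < E2 i) ∧
          {x ∈ Orthant | auxMono b K γ r νI μI νY μY δ μF μM α YP x = 0} =
            {0, E1, E2} ∧
          (∀ x : ℝ → Fin 4 → ℝ,
            IsSolOn (auxMono b K γ r νI μI νY μY δ μF μM α YP) Orthant x →
            (∀ i, x 0 i < E1 i) → Tendsto x atTop (𝓝 0)) ∧
          (∀ x : ℝ → Fin 4 → ℝ,
            IsSolOn (auxMono b K γ r νI μI νY μY δ μF μM α YP) Orthant x →
            (∀ i, E2 i ≤ x 0 i) → x 0 0 ≤ K → Tendsto x atTop (𝓝 E2))) := by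
  have h1r : 0 < 1 - r := by linarith
  have hD0 : 0 < (νY + μY) * (δ + μF) - δ * νY := by
    have : (νY + μY) * (δ + μF) - δ * νY = νY * μF + μY * (δ + μF) := by ring
    rw [this]; positivity
  have hN1 : (μI + νI) * ((νY + μY) * (δ + μF) - δ * νY) < b * r * νI * νY := by
    rw [hN0, one_lt_div (by positivity)] at hgt
    exact hgt
  have hIpos : 0 < Istar := by
    rw [hIs]
    refine mul_pos ?_ hK
    rw [sub_pos, div_lt_one (by linarith)]
    exact hgt
  have hAB : (νI + μI) * (δ + μF) * μM < (νY * γ) * ((1 - r) * νI) * b := by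
    set D0 := (νY + μY) * (δ + μF) - δ * νY with hD0d
    have h1 : r * νI * (δ + μF) * Istar * μM < γ * ((1 - r) * νI * Istar) * D0 := by
      rw [hYs, hMs, ← mul_div_assoc, div_lt_div_iff₀ hD0 hμM] at habund
      exact habund
    have h2 : r * (δ + μF) * μM < γ * (1 - r) * D0 := by
      have h3 : (νI * Istar) * (r * (δ + μF) * μM) < (νI * Istar) * (γ * (1 - r) * D0) := by
        linarith
      exact lt_of_mul_lt_mul_left h3 (by positivity)
    have h4 : (νI * νY * b) * (r * (δ + μF) * μM) < (νI * νY * b) * (γ * (1 - r) * D0) :=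
      mul_lt_mul_of_pos_left h2 (by positivity)
    have h5 : ((δ + μF) * μM) * ((μI + νI) * D0) < ((δ + μF) * μM) * (b * r * νI * νY) :=
      mul_lt_mul_of_pos_left hN1 (by positivity)
    have h6 : ((νI + μI) * (δ + μF) * μM) * D0 < ((νY * γ) * ((1 - r) * νI) * b) * D0 := by
      linarith
    exact lt_of_mul_lt_mul_right h6 hD0.le
  let z : Prm :=
    { b := b, K := K, c := νI + μI, p := r * νI, m := μY, e := δ, g := νY * γ, d := δ + μF,
      q := (1 - r) * νI, μ := μM, α := α, P := 1, hb := hb, hK := hK, hc := by positivity,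
      hp := by positivity, hm := hμY, he := hδ, hg := by positivity, hd := by positivity,
      hq := by positivity, hμ := hμM, hα := hα, hP := one_pos }
  have hvf : ∀ YP (hYP : 0 < YP), auxMono b K γ r νI μI νY μY δ μF μM α YP = (z.setP YP hYP).vf := by
    intro YP hYP
    funext x
    ext i
    fin_cases i
    · rfl
    · rfl
    · show νY * γ * x 3 * x 1 / (x 1 + YP) - (δ + μF) * x 2
        = νY * γ * (x 3 * (x 1 / (x 1 + YP))) - (δ + μF) * x 2
      ring
    · rfl
  obtain ⟨T, hT, hA, hB⟩ := z.threshold hAB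
  refine ⟨T, hT, ?_, ?_⟩
  · intro YP hYP
    have hYP0 := hT.trans hYP
    refine ⟨?_, ?_⟩
    · intro I hI heq
      have hIK : I < K := by
        refine hI.2.trans_le ?_
        rw [hI1]
        have : 0 ≤ (δ + μF) * (νI + μI) * μM / (νY * γ * (1 - r) * νI * b) := by positivity
        have h2 := mul_le_mul_of_nonneg_left (show 1 - (δ + μF) * (νI + μI) * μM /
          (νY * γ * (1 - r) * νI * b) ≤ 1 by linarith) hK.le
        linarith
      have hd1 : I / K < 1 := by rw [div_lt_one hK]; exact hIK
      have hd0 : 0 < I / K := div_pos hI.1 hK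
      have h := hA YP hYP (1 - I / K) (by linarith) (by linarith)
      have hq : z.qol (1 - I / K) =
          I * (νY * γ * (1 - r) * νI * b * (1 - I / K) - (δ + μF) * (νI + μI) * μM) *
              (r * νI * b * (1 - I / K) + δ * (νI + μI)) := by
        show K * (1 - (1 - I / K)) * ((νY * γ) * ((1 - r) * νI) * b * (1 - I / K)
          - (νI + μI) * (δ + μF) * μM) * (r * νI * b * (1 - I / K) + δ * (νI + μI)) = _
        have : K * (1 - (1 - I / K)) = I := by field_simp; ring
        rw [this]; ring
      have hc : z.cc = b * μY * (νI + μI) * (δ + μF) * (μM + α) := rfl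
      rw [hq, heq, hc] at h
      apply lt_irrefl (0 : ℝ)
      refine lt_of_eq_of_lt ?_ h
      ring
    · rw [hvf YP hYP0]
      refine Prm.gas _ fun G hG => ?_
      rw [Prm.Phi_lt_iff _ hG, Prm.setP_pol]
      exact hA YP hYP _ (Prm.uu_pos _ hG) (Prm.uu_le _ hG)
  · intro YP hYP0 hYP
    obtain ⟨x, y, p3, w, hx, hxy, hy, h3, hw, hall⟩ := hB YP hYP0 hYP
    obtain ⟨G1, G2, a1, a2, a3, a4, a5, a6, a7⟩ :=
      (z.setP YP hYP0).two_states hx hxy hy h3 hw (fun u => by rw [Prm.setP_pol]; exact hall u)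
    rw [hvf YP hYP0]
    exact (z.setP YP hYP0).bistable a1 a2 a3 a4 a5 a6 a7
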